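/- Let Φ_H(u) = max(1+u, 0) be the hinge loss and assume max_{j=1,…,M} ‖φ_j‖_{P_X,∞} ≤ L_φ for some L_φ > 0. Then for every β > 0, the mirror averaging aggregate f̂_n based on the sparsity prior (parameters M ≥ 2, τ > 0, R > 2Mτ) satisfies: E[ℓ_{Φ_H}(f̂_n, f)] ≤ min over λ* with ‖λ*‖₁ ≤ R − 2Mτ of ( ℓ_{Φ_H}(f_{λ*}, f) + (4β/(n+1)) ∑_{j=1}^M log(1 + τ⁻¹|λ*_j|) ) + (2(1+RL_φ)²/β) e^{(1+RL_φ)/β} + 4τ L_φ √M + β/(n+1). -/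

import Mathlib

open MeasureTheory

lemma pi_withDensity_ofReal {ι : Type*} [Fintype ι] {p : ℝ → ℝ} (hp : ∀ t, 0 ≤ p t)
    (hint : Integrable p) :
    Measure.pi (fun _ : ι => (volume : Measure ℝ).withDensity fun t => ENNReal.ofReal (p t)) =
      (volume : Measure (ι → ℝ)).withDensity fun l => ENNReal.ofReal (∏ j, p (l j)) := by
  have : IsFiniteMeasure ((volume : Measure ℝ).withDensity fun t => ENNReal.ofReal (p t)) :=
    isFiniteMeasure_withDensity_ofReal hint.2
  refine Measure.pi_eq fun s hs => ?_
  have hbox : MeasurableSet (Set.univ.pi s) := MeasurableSet.univ_pi hs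
  have hprod : ∀ l : ι → ℝ, (Set.univ.pi s).indicator (fun l => ENNReal.ofReal (∏ j, p (l j))) l =
      ENNReal.ofReal (∏ j, (s j).indicator p (l j)) := by
    intro l
    by_cases hl : l ∈ Set.univ.pi s
    · rw [Set.indicator_of_mem hl]
      congr 1
      exact Finset.prod_congr rfl fun j _ => (Set.indicator_of_mem (hl j trivial) _).symm
    · rw [Set.indicator_of_notMem hl]
      simp only [Set.mem_univ_pi, not_forall] at hl
      obtain ⟨j, hj⟩ := hl
      rw [Finset.prod_eq_zero (Finset.mem_univ j) (Set.indicator_of_notMem hj _)]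
      simp
  have hnn : ∀ j t, 0 ≤ (s j).indicator p t := fun j t => Set.indicator_nonneg (fun t _ => hp t) t
  have hi : ∀ j, Integrable ((s j).indicator p) := fun j => hint.indicator (hs j)
  rw [withDensity_apply _ hbox, ← lintegral_indicator hbox, lintegral_congr hprod,
    ← ofReal_integral_eq_lintegral_ofReal, volume_pi,
    integral_fintype_prod_eq_prod (fun j => (s j).indicator p),
    ENNReal.ofReal_prod_of_nonneg fun j _ => integral_nonneg (hnn j)]
  · refine Finset.prod_congr rfl fun j _ => ?_
    rw [withDensity_apply _ (hs j), ofReal_integral_eq_lintegral_ofReal (hi j)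
      (Filter.Eventually.of_forall (hnn j)), ← lintegral_indicator (hs j)]
    refine lintegral_congr fun t => ?_
    by_cases ht : t ∈ s j <;> simp [ht]
  · exact Integrable.fintype_prod_dep hi
  · exact Filter.Eventually.of_forall fun l => Finset.prod_nonneg fun j _ => hnn j _

lemma integrable_inv_sq_add_sq {τ : ℝ} (hτ : 0 < τ) :
    Integrable fun t : ℝ => (τ ^ 2 + t ^ 2)⁻¹ := by
  refine (integrable_inv_one_add_sq.const_mul (1 + (τ ^ 2)⁻¹)).mono' (by fun_prop) ?_
  refine Filter.Eventually.of_forall fun t => ?_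
  rw [Real.norm_of_nonneg (by positivity)]
  rw [← div_eq_mul_inv, inv_eq_one_div, div_le_div_iff₀ (by positivity) (by positivity)]
  have h1 : (τ ^ 2)⁻¹ * τ ^ 2 = 1 := inv_mul_cancel₀ (by positivity)
  have h2 : 0 ≤ (τ ^ 2)⁻¹ * t ^ 2 := by positivity
  nlinarith [sq_nonneg τ]

lemma integrable_inv_sq_add_sq_sq {τ : ℝ} (hτ : 0 < τ) :
    Integrable fun t : ℝ => ((τ ^ 2 + t ^ 2) ^ 2)⁻¹ := by
  refine ((integrable_inv_sq_add_sq hτ).const_mul (τ ^ 2)⁻¹).mono' (by fun_prop) ?_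
  refine Filter.Eventually.of_forall fun t => ?_
  rw [Real.norm_of_nonneg (by positivity), ← mul_inv]
  apply inv_anti₀ (by positivity)
  nlinarith [mul_nonneg (sq_nonneg t) (sq_nonneg τ), sq_nonneg (t ^ 2)]

lemma integrable_sq_mul_inv_sq_add_sq_sq {τ : ℝ} (hτ : 0 < τ) :
    Integrable fun t : ℝ => t ^ 2 * ((τ ^ 2 + t ^ 2) ^ 2)⁻¹ := by
  refine (integrable_inv_sq_add_sq hτ).mono' (by fun_prop) ?_
  refine Filter.Eventually.of_forall fun t => ?_
  rw [Real.norm_of_nonneg (by positivity), ← div_eq_mul_inv, inv_eq_one_div,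
    div_le_div_iff₀ (by positivity) (by positivity)]
  nlinarith [mul_nonneg (sq_nonneg t) (sq_nonneg τ), sq_nonneg (τ ^ 2)]

lemma integral_sq_mul_inv_sq_add_sq_sq {τ : ℝ} (hτ : 0 < τ) :
    ∫ t : ℝ, t ^ 2 * ((τ ^ 2 + t ^ 2) ^ 2)⁻¹ = τ ^ 2 * ∫ t : ℝ, ((τ ^ 2 + t ^ 2) ^ 2)⁻¹ := by
  have h1 := integrable_inv_sq_add_sq_sq hτ
  have h2 := integrable_sq_mul_inv_sq_add_sq_sq hτ
  have hd : ∀ t : ℝ, HasDerivAt (fun t : ℝ => t / (τ ^ 2 + t ^ 2))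
      (τ ^ 2 * ((τ ^ 2 + t ^ 2) ^ 2)⁻¹ - t ^ 2 * ((τ ^ 2 + t ^ 2) ^ 2)⁻¹) t := by
    intro t
    have hne : τ ^ 2 + t ^ 2 ≠ 0 := by positivity
    have hnum : HasDerivAt (fun t : ℝ => t) 1 t := hasDerivAt_id t
    have hden : HasDerivAt (fun t : ℝ => τ ^ 2 + t ^ 2) (2 * t) t := by
      simpa using (hasDerivAt_pow 2 t).const_add (τ ^ 2)
    refine (hnum.div hden hne).congr_deriv ?_
    field_simp
    ring
  have hle : ∀ t : ℝ, ‖t / (τ ^ 2 + t ^ 2)‖ ≤ |t⁻¹| := by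
    intro t
    rcases eq_or_ne t 0 with rfl | ht
    · simp
    · have : 0 < |t| := abs_pos.mpr ht
      rw [Real.norm_eq_abs, abs_div, abs_of_pos (show 0 < τ ^ 2 + t ^ 2 by positivity), abs_inv,
        inv_eq_one_div, div_le_div_iff₀ (by positivity) this]
      nlinarith [sq_abs t, sq_nonneg τ]
  have hbot : Filter.Tendsto (fun t : ℝ => t / (τ ^ 2 + t ^ 2)) Filter.atBot (nhds 0) :=
    squeeze_zero_norm hle (by simpa using (tendsto_inv_atBot_zero (𝕜 := ℝ)).abs)
  have htop : Filter.Tendsto (fun t : ℝ => t / (τ ^ 2 + t ^ 2)) Filter.atTop (nhds 0) :=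
    squeeze_zero_norm hle (by simpa using (tendsto_inv_atTop_zero (𝕜 := ℝ)).abs)
  have := integral_of_hasDerivAt_of_tendsto hd ((h1.const_mul _).sub h2) hbot htop
  rw [integral_sub (h1.const_mul _) h2, integral_const_mul] at this
  linarith

lemma inv_sq_add_sq_sq_translate_le {τ : ℝ} (hτ : 0 < τ) (u a : ℝ) :
    ((1 + τ⁻¹ * |a|) ^ 4)⁻¹ * ((τ ^ 2 + u ^ 2) ^ 2)⁻¹ ≤ ((τ ^ 2 + (u + a) ^ 2) ^ 2)⁻¹ := by
  rw [← mul_inv]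
  apply inv_anti₀ (by positivity)
  have key : τ ^ 2 + (u + a) ^ 2 ≤ (1 + τ⁻¹ * |a|) ^ 2 * (τ ^ 2 + u ^ 2) := by
    obtain ⟨s, hs⟩ : ∃ s, s = τ⁻¹ * |a| := ⟨_, rfl⟩
    have hs0 : 0 ≤ s := by rw [hs]; positivity
    have ha : |a| = τ * s := by rw [hs]; field_simp
    have ha2 : a ^ 2 = (τ * s) ^ 2 := by rw [← ha, sq_abs]
    have hua : u * a ≤ |u| * (τ * s) := by rw [← ha, ← abs_mul]; exact le_abs_self _
    rw [← hs]
    nlinarith [mul_nonneg hs0 (sq_nonneg (τ - |u|)), sq_abs u,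
      mul_nonneg (sq_nonneg s) (sq_nonneg u)]
  calc (τ ^ 2 + (u + a) ^ 2) ^ 2 ≤ ((1 + τ⁻¹ * |a|) ^ 2 * (τ ^ 2 + u ^ 2)) ^ 2 := by gcongr
    _ = _ := by ring

/-- The probability measure on `ℝ` with density proportional to `(τ ^ 2 + t ^ 2) ^ (-2)`. -/
noncomputable def studentMeasure (τ : ℝ) : Measure ℝ :=
  volume.withDensity fun t => ENNReal.ofReal
    ((∫ s : ℝ, ((τ ^ 2 + s ^ 2) ^ 2)⁻¹)⁻¹ * ((τ ^ 2 + t ^ 2) ^ 2)⁻¹)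

lemma integral_inv_sq_add_sq_sq_pos {τ : ℝ} (hτ : 0 < τ) :
    0 < ∫ s : ℝ, ((τ ^ 2 + s ^ 2) ^ 2)⁻¹ := by
  refine integral_pos_of_integrable_nonneg_nonzero (x := 0) ?_ (integrable_inv_sq_add_sq_sq hτ)
    (fun t => by positivity) (by positivity)
  exact Continuous.inv₀ (by fun_prop) fun t => by positivity

lemma isProbabilityMeasure_studentMeasure {τ : ℝ} (hτ : 0 < τ) :
    IsProbabilityMeasure (studentMeasure τ) := by
  have hA := integral_inv_sq_add_sq_sq_pos hτ
  constructor
  rw [studentMeasure, withDensity_apply _ MeasurableSet.univ, setLIntegral_univ,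
    ← ofReal_integral_eq_lintegral_ofReal ((integrable_inv_sq_add_sq_sq hτ).const_mul _)
      (Filter.Eventually.of_forall fun t => by positivity),
    integral_const_mul, inv_mul_cancel₀ hA.ne', ENNReal.ofReal_one]

lemma integrable_studentMeasure_iff {τ : ℝ} (hτ : 0 < τ) {f : ℝ → ℝ} :
    Integrable f (studentMeasure τ) ↔
      Integrable fun t => f t * ((∫ s : ℝ, ((τ ^ 2 + s ^ 2) ^ 2)⁻¹)⁻¹ *
        ((τ ^ 2 + t ^ 2) ^ 2)⁻¹) := by
  have hA := integral_inv_sq_add_sq_sq_pos hτ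
  rw [studentMeasure, integrable_withDensity_iff (by fun_prop)
    (Filter.Eventually.of_forall fun _ => ENNReal.ofReal_lt_top)]
  refine iff_of_eq (congrArg (Integrable · volume) (funext fun t => ?_))
  rw [ENNReal.toReal_ofReal (by positivity)]

lemma integral_studentMeasure {τ : ℝ} (hτ : 0 < τ) (f : ℝ → ℝ) :
    ∫ t, f t ∂studentMeasure τ = ∫ t, (∫ s : ℝ, ((τ ^ 2 + s ^ 2) ^ 2)⁻¹)⁻¹ *
        ((τ ^ 2 + t ^ 2) ^ 2)⁻¹ * f t := by
  have hA := integral_inv_sq_add_sq_sq_pos hτ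
  rw [studentMeasure, integral_withDensity_eq_integral_toReal_smul (by fun_prop)
    (Filter.Eventually.of_forall fun _ => ENNReal.ofReal_lt_top)]
  refine integral_congr_ae (Filter.Eventually.of_forall fun t => ?_)
  simp only [smul_eq_mul]
  rw [ENNReal.toReal_ofReal (by positivity)]

lemma integrable_sq_studentMeasure {τ : ℝ} (hτ : 0 < τ) :
    Integrable (fun t => t ^ 2) (studentMeasure τ) := by
  rw [integrable_studentMeasure_iff hτ]
  convert (integrable_sq_mul_inv_sq_add_sq_sq hτ).const_mul
    (∫ s : ℝ, ((τ ^ 2 + s ^ 2) ^ 2)⁻¹)⁻¹ using 2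
  ring

lemma integral_sq_studentMeasure {τ : ℝ} (hτ : 0 < τ) :
    ∫ t, t ^ 2 ∂studentMeasure τ = τ ^ 2 := by
  have hA := integral_inv_sq_add_sq_sq_pos hτ
  rw [integral_studentMeasure hτ]
  simp_rw [mul_assoc, mul_comm (((_ : ℝ) ^ 2)⁻¹) (_ ^ 2)]
  rw [integral_const_mul, integral_sq_mul_inv_sq_add_sq_sq hτ, mul_left_comm,
    inv_mul_cancel₀ hA.ne', mul_one]

lemma memLp_id_studentMeasure {τ : ℝ} (hτ : 0 < τ) : MemLp id 2 (studentMeasure τ) :=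
  (memLp_two_iff_integrable_sq aestronglyMeasurable_id).2 (integrable_sq_studentMeasure hτ)

lemma integral_id_studentMeasure {τ : ℝ} (hτ : 0 < τ) : ∫ t, t ∂studentMeasure τ = 0 := by
  rw [integral_studentMeasure hτ]
  have h := integral_neg_eq_self (fun t : ℝ => (∫ s : ℝ, ((τ ^ 2 + s ^ 2) ^ 2)⁻¹)⁻¹ *
    ((τ ^ 2 + t ^ 2) ^ 2)⁻¹ * t) volume
  simp only [even_two, Even.neg_pow, mul_neg, integral_neg] at h
  linarith

lemma integral_abs_studentMeasure_le {τ : ℝ} (hτ : 0 < τ) : ∫ t, |t| ∂studentMeasure τ ≤ τ := by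
  have := isProbabilityMeasure_studentMeasure hτ
  have hsq := integrable_sq_studentMeasure hτ
  have hid : Integrable (fun t : ℝ => t) (studentMeasure τ) :=
    (memLp_id_studentMeasure hτ).integrable (by norm_num)
  calc ∫ t, |t| ∂studentMeasure τ
      ≤ ∫ t, ((2 * τ)⁻¹ * t ^ 2 + τ / 2) ∂studentMeasure τ := by
        refine integral_mono hid.abs ((hsq.const_mul _).add (integrable_const _)) fun t => ?_
        have h : (2 * τ)⁻¹ * t ^ 2 + τ / 2 - |t| = (2 * τ)⁻¹ * (|t| - τ) ^ 2 := by
          field_simp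
          rw [← sq_abs t]
          ring
        have : 0 ≤ (2 * τ)⁻¹ * (|t| - τ) ^ 2 := by positivity
        simp only
        linarith
    _ = τ := by
        rw [integral_add (hsq.const_mul _) (integrable_const _), integral_const_mul,
          integral_sq_studentMeasure hτ]
        simp
        field_simp
        norm_num

lemma integral_sq_sum_mul_pi_studentMeasure_le {M : ℕ} {τ L : ℝ} (hτ : 0 < τ)
    (v : Fin M → ℝ) (hv : ∀ j, |v j| ≤ L) :
    MemLp (fun u : Fin M → ℝ => ∑ j, u j * v j) 2 (Measure.pi fun _ => studentMeasure τ) ∧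
    ∫ u, (∑ j, u j * v j) ^ 2 ∂(Measure.pi fun _ : Fin M => studentMeasure τ) ≤
      M * (τ ^ 2 * L ^ 2) := by
  have := isProbabilityMeasure_studentMeasure hτ
  have hL : ∀ j, MemLp (fun t : ℝ => t * v j) 2 (studentMeasure τ) := fun j =>
    (memLp_id_studentMeasure hτ).mul_const (v j)
  have hLpi : ∀ j, MemLp (fun u : Fin M → ℝ => u j * v j) 2
      (Measure.pi fun _ => studentMeasure τ) := fun j =>
    (hL j).comp_measurePreserving (measurePreserving_eval (fun _ : Fin M => studentMeasure τ) j)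
  have hmem : MemLp (fun u : Fin M → ℝ => ∑ j, u j * v j) 2
      (Measure.pi fun _ => studentMeasure τ) := memLp_finsetSum _ fun j _ => hLpi j
  refine ⟨hmem, ?_⟩
  have hmean : ∫ u, (∑ j, u j * v j) ∂(Measure.pi fun _ : Fin M => studentMeasure τ) = 0 := by
    rw [integral_finsetSum _ fun j _ => (hLpi j).integrable (by norm_num)]
    refine Finset.sum_eq_zero fun j _ => ?_
    rw [integral_comp_eval (μ := fun _ : Fin M => studentMeasure τ) (i := j)
      (f := fun t : ℝ => t * v j) (by fun_prop), integral_mul_const,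
      integral_id_studentMeasure hτ, zero_mul]
  have hvar := ProbabilityTheory.variance_eq_sub hmem
  have hsum := ProbabilityTheory.variance_sum_pi (μ := fun _ : Fin M => studentMeasure τ) hL
  have heq : (∑ j, fun u : Fin M → ℝ => u j * v j) = fun u => ∑ j, u j * v j := by
    ext u; simp
  rw [heq] at hsum
  rw [hsum, hmean] at hvar
  simp only [Pi.pow_apply] at hvar
  have hle : ∀ j ∈ Finset.univ, ProbabilityTheory.variance (fun t : ℝ => t * v j)
      (studentMeasure τ) ≤ τ ^ 2 * L ^ 2 := by
    intro j _
    refine (ProbabilityTheory.variance_le_expectation_sq (by fun_prop)).trans ?_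
    simp only [Pi.pow_apply, mul_pow]
    rw [integral_mul_const, integral_sq_studentMeasure hτ]
    have : v j ^ 2 ≤ L ^ 2 := sq_le_sq' (by linarith [abs_le.1 (hv j)]) (abs_le.1 (hv j)).2
    gcongr
  have := Finset.sum_le_card_nsmul _ _ _ hle
  simp only [Finset.card_univ, Fintype.card_fin, nsmul_eq_mul] at this
  linarith

lemma half_le_pi_studentMeasure_l1_ball {M : ℕ} (hM : 0 < M) {τ : ℝ} (hτ : 0 < τ) :
    1 / 2 ≤ (Measure.pi fun _ : Fin M => studentMeasure τ).real
      {u | ∑ j, |u j| ≤ 2 * M * τ} := by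
  have := isProbabilityMeasure_studentMeasure hτ
  have hM' : (0 : ℝ) < M := by exact_mod_cast hM
  have hid : Integrable (fun t : ℝ => |t|) (studentMeasure τ) :=
    ((memLp_id_studentMeasure hτ).integrable (by norm_num)).abs
  have hint : ∀ j, Integrable (fun u : Fin M → ℝ => |u j|)
      (Measure.pi fun _ => studentMeasure τ) := fun j =>
    integrable_comp_eval (μ := fun _ : Fin M => studentMeasure τ) (i := j) hid
  have hexp : ∫ u, (∑ j, |u j|) ∂(Measure.pi fun _ : Fin M => studentMeasure τ) ≤ M * τ := by
    rw [integral_finsetSum _ fun j _ => hint j]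
    have hle : ∀ j ∈ Finset.univ, ∫ u, |u j| ∂(Measure.pi fun _ : Fin M => studentMeasure τ)
        ≤ τ := by
      intro j _
      rw [integral_comp_eval (μ := fun _ : Fin M => studentMeasure τ) (i := j)
        (f := fun t : ℝ => |t|) (by fun_prop)]
      exact integral_abs_studentMeasure_le hτ
    simpa using Finset.sum_le_card_nsmul _ _ _ hle
  have hmarkov := mul_meas_ge_le_integral_of_nonneg
    (μ := Measure.pi fun _ : Fin M => studentMeasure τ) (f := fun u => ∑ j, |u j|)
    (Filter.Eventually.of_forall fun u => Finset.sum_nonneg fun j _ => abs_nonneg _)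
    (integrable_finsetSum _ fun j _ => hint j) (2 * M * τ)
  have hmeas : MeasurableSet {u : Fin M → ℝ | ∑ j, |u j| ≤ 2 * M * τ} :=
    measurableSet_le (by fun_prop) (by fun_prop)
  have hcompl := probReal_compl_eq_one_sub (μ := Measure.pi fun _ : Fin M => studentMeasure τ)
    hmeas
  have hsub : (Measure.pi fun _ : Fin M => studentMeasure τ).real
      {u | ∑ j, |u j| ≤ 2 * M * τ}ᶜ ≤ (Measure.pi fun _ : Fin M => studentMeasure τ).real
      {u | 2 * M * τ ≤ ∑ j, |u j|} := by
    refine measureReal_mono fun u hu => ?_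
    simp only [Set.mem_compl_iff, Set.mem_ofPred_eq, not_le] at hu ⊢
    exact hu.le
  have hpos : 0 < M * τ := by positivity
  have : (Measure.pi fun _ : Fin M => studentMeasure τ).real
      {u | 2 * M * τ ≤ ∑ j, |u j|} ≤ 1 / 2 := by
    by_contra! hcon
    nlinarith
  linarith

lemma pi_studentMeasure_eq_withDensity {M : ℕ} {τ : ℝ} (hτ : 0 < τ) :
    (Measure.pi fun _ : Fin M => studentMeasure τ) = volume.withDensity fun l => ENNReal.ofReal
      (((∫ s : ℝ, ((τ ^ 2 + s ^ 2) ^ 2)⁻¹)⁻¹) ^ M * ∏ j, ((τ ^ 2 + l j ^ 2) ^ 2)⁻¹) := by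
  have hA := integral_inv_sq_add_sq_sq_pos hτ
  unfold studentMeasure
  rw [pi_withDensity_ofReal (fun t => by positivity)
    ((integrable_inv_sq_add_sq_sq hτ).const_mul _)]
  simp [Finset.prod_mul_distrib]

/-- The sparsity prior dominates the translate by `a` of the conditioned product measure. -/
lemma smul_map_cond_pi_studentMeasure_le {M : ℕ} (hM : 0 < M) {τ R c : ℝ} (hτ : 0 < τ)
    (hc : 0 < c) {π : Measure (Fin M → ℝ)}
    (hπ : π = volume.withDensity fun l => ENNReal.ofReal
      (if (∑ j, |l j|) ≤ R then c * ∏ j, ((τ ^ 2 + l j ^ 2) ^ 2)⁻¹ else 0))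
    (hπprob : IsProbabilityMeasure π) (a : Fin M → ℝ) (ha : ∑ j, |a j| ≤ R - 2 * M * τ) :
    ENNReal.ofReal (1 / 2 * ∏ j, ((1 + τ⁻¹ * |a j|) ^ 4)⁻¹) •
      (ProbabilityTheory.cond (Measure.pi fun _ : Fin M => studentMeasure τ)
        {u | ∑ j, |u j| ≤ 2 * M * τ}).map (fun u => u + a) ≤ π := by
  have := isProbabilityMeasure_studentMeasure hτ
  set A : ℝ := ∫ s : ℝ, ((τ ^ 2 + s ^ 2) ^ 2)⁻¹ with hAdef
  have hA : 0 < A := integral_inv_sq_add_sq_sq_pos hτ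
  set ν := Measure.pi fun _ : Fin M => studentMeasure τ with hν
  set B : Set (Fin M → ℝ) := {u | ∑ j, |u j| ≤ 2 * M * τ} with hB
  set K : ℝ := ∏ j, ((1 + τ⁻¹ * |a j|) ^ 4)⁻¹ with hK
  have hK0 : 0 ≤ K := Finset.prod_nonneg fun j _ => by positivity
  have hBm : MeasurableSet B := measurableSet_le (by fun_prop) (by fun_prop)
  have hνd : ν = volume.withDensity fun l => ENNReal.ofReal
      ((A⁻¹) ^ M * ∏ j, ((τ ^ 2 + l j ^ 2) ^ 2)⁻¹) := pi_studentMeasure_eq_withDensity hτ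
  have hw : ∀ l : Fin M → ℝ, 0 ≤ ∏ j, ((τ ^ 2 + l j ^ 2) ^ 2)⁻¹ := fun l =>
    Finset.prod_nonneg fun j _ => by positivity
  have hcA : 1 ≤ c * A ^ M := by
    have h1 : (1 : ENNReal) ≤ ENNReal.ofReal (c * A ^ M) := by
      calc (1 : ENNReal) = π Set.univ := by simp
        _ = ∫⁻ l : Fin M → ℝ, ENNReal.ofReal (if (∑ j, |l j|) ≤ R then
              c * ∏ j, ((τ ^ 2 + l j ^ 2) ^ 2)⁻¹ else 0) := by
            rw [hπ, withDensity_apply _ MeasurableSet.univ, setLIntegral_univ]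
        _ ≤ ∫⁻ l : Fin M → ℝ, ENNReal.ofReal (c * A ^ M) * ENNReal.ofReal
              ((A⁻¹) ^ M * ∏ j, ((τ ^ 2 + l j ^ 2) ^ 2)⁻¹) := by
            refine lintegral_mono fun l => ?_
            rw [← ENNReal.ofReal_mul (by positivity)]
            refine ENNReal.ofReal_le_ofReal ?_
            have : c * A ^ M * ((A⁻¹) ^ M * ∏ j, ((τ ^ 2 + l j ^ 2) ^ 2)⁻¹) =
                c * ∏ j, ((τ ^ 2 + l j ^ 2) ^ 2)⁻¹ := by
              rw [inv_pow]; field_simp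
            rw [this]
            split_ifs
            · exact le_rfl
            · exact mul_nonneg hc.le (hw l)
        _ = ENNReal.ofReal (c * A ^ M) * ν Set.univ := by
            rw [lintegral_const_mul' _ _ ENNReal.ofReal_ne_top, hνd,
              withDensity_apply _ MeasurableSet.univ, setLIntegral_univ]
        _ = ENNReal.ofReal (c * A ^ M) := by simp
    rwa [ENNReal.one_le_ofReal] at h1
  have hhalf : ENNReal.ofReal (1 / 2) * (ν B)⁻¹ ≤ 1 := by
    have hb : ENNReal.ofReal (1 / 2) ≤ ν B := by
      rw [ENNReal.ofReal_le_iff_le_toReal (measure_ne_top _ _)]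
      exact half_le_pi_studentMeasure_l1_ball hM hτ
    rw [← div_eq_mul_inv]
    exact ENNReal.div_le_of_le_mul (by rwa [one_mul])
  refine Measure.le_iff.2 fun S hS => ?_
  have hT : MeasurableSet ((fun u : Fin M → ℝ => u + a) ⁻¹' S) :=
    (measurable_add_const a) hS
  set T := (fun u : Fin M → ℝ => u + a) ⁻¹' S with hTdef
  rw [Measure.smul_apply, smul_eq_mul, Measure.map_apply (measurable_add_const a) hS,
    ProbabilityTheory.cond_apply hBm, ENNReal.ofReal_mul (by norm_num)]
  calc ENNReal.ofReal (1 / 2) * ENNReal.ofReal K * ((ν B)⁻¹ * ν (B ∩ T))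
      = (ENNReal.ofReal (1 / 2) * (ν B)⁻¹) * (ENNReal.ofReal K * ν (B ∩ T)) := by ring
    _ ≤ 1 * (ENNReal.ofReal K * ν (B ∩ T)) := by gcongr
    _ = ∫⁻ u in B ∩ T, ENNReal.ofReal K * ENNReal.ofReal
          ((A⁻¹) ^ M * ∏ j, ((τ ^ 2 + u j ^ 2) ^ 2)⁻¹) := by
        rw [one_mul, lintegral_const_mul' _ _ ENNReal.ofReal_ne_top, hνd,
          withDensity_apply _ (hBm.inter hT)]
    _ ≤ ∫⁻ u in B ∩ T, ENNReal.ofReal (if (∑ j, |(u + a) j|) ≤ R then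
              c * ∏ j, ((τ ^ 2 + (u + a) j ^ 2) ^ 2)⁻¹ else 0) := by
        refine setLIntegral_mono' (hBm.inter hT) fun u hu => ?_
        have hub : ∑ j, |u j| ≤ 2 * M * τ := hu.1
        have hR : ∑ j, |(u + a) j| ≤ R := by
          calc ∑ j, |(u + a) j| ≤ ∑ j, (|u j| + |a j|) :=
                Finset.sum_le_sum fun j _ => abs_add_le _ _
            _ ≤ R := by rw [Finset.sum_add_distrib]; linarith
        rw [if_pos hR, ← ENNReal.ofReal_mul hK0]
        refine ENNReal.ofReal_le_ofReal ?_
        have h1 : K * ∏ j, ((τ ^ 2 + u j ^ 2) ^ 2)⁻¹ ≤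
            ∏ j, ((τ ^ 2 + (u + a) j ^ 2) ^ 2)⁻¹ := by
          rw [hK, ← Finset.prod_mul_distrib]
          exact Finset.prod_le_prod (fun j _ => by positivity) fun j _ =>
            inv_sq_add_sq_sq_translate_le hτ (u j) (a j)
        have h2 : (A⁻¹) ^ M ≤ c := by
          rw [inv_pow, inv_le_iff_one_le_mul₀ (by positivity)]
          exact hcA
        calc K * ((A⁻¹) ^ M * ∏ j, ((τ ^ 2 + u j ^ 2) ^ 2)⁻¹)
            = (A⁻¹) ^ M * (K * ∏ j, ((τ ^ 2 + u j ^ 2) ^ 2)⁻¹) := by ring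
          _ ≤ c * ∏ j, ((τ ^ 2 + (u + a) j ^ 2) ^ 2)⁻¹ :=
              mul_le_mul h2 h1 (mul_nonneg hK0 (hw u)) hc.le
    _ ≤ ∫⁻ u in T, ENNReal.ofReal (if (∑ j, |(u + a) j|) ≤ R then
              c * ∏ j, ((τ ^ 2 + (u + a) j ^ 2) ^ 2)⁻¹ else 0) :=
        lintegral_mono_set Set.inter_subset_right
    _ = π S := by
        rw [hπ, withDensity_apply _ hS, hTdef]
        exact (measurePreserving_add_right volume a).setLIntegral_comp_preimage_emb
          (MeasurableEquiv.addRight a).measurableEmbedding (fun l => ENNReal.ofReal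
            (if (∑ j, |l j|) ≤ R then c * ∏ j, ((τ ^ 2 + l j ^ 2) ^ 2)⁻¹ else 0)) S

lemma exists_measure_smul_le_sparsityPrior {M : ℕ} (hM : 0 < M) {τ R c : ℝ} (hτ : 0 < τ)
    (hc : 0 < c) {π : Measure (Fin M → ℝ)}
    (hπ : π = volume.withDensity fun l => ENNReal.ofReal
      (if (∑ j, |l j|) ≤ R then c * ∏ j, ((τ ^ 2 + l j ^ 2) ^ 2)⁻¹ else 0))
    (hπprob : IsProbabilityMeasure π) (a : Fin M → ℝ) (ha : ∑ j, |a j| ≤ R - 2 * M * τ) :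
    ∃ ρ : Measure (Fin M → ℝ), IsProbabilityMeasure ρ ∧
      ENNReal.ofReal (1 / 2 * ∏ j, ((1 + τ⁻¹ * |a j|) ^ 4)⁻¹) • ρ ≤ π ∧
      ∀ L, 0 < L → ∀ v : Fin M → ℝ, (∀ j, |v j| ≤ L) →
        Integrable (fun l => |∑ j, (l j - a j) * v j|) ρ ∧
        ∫ l, |∑ j, (l j - a j) * v j| ∂ρ ≤ 4 * τ * L * Real.sqrt M := by
  have := isProbabilityMeasure_studentMeasure hτ
  set ν := Measure.pi fun _ : Fin M => studentMeasure τ with hν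
  set B : Set (Fin M → ℝ) := {u | ∑ j, |u j| ≤ 2 * M * τ} with hB
  have hhalf : 1 / 2 ≤ ν.real B := half_le_pi_studentMeasure_l1_ball hM hτ
  have hBm : MeasurableSet B := measurableSet_le (by fun_prop) (by fun_prop)
  have hB0 : ν B ≠ 0 := fun h => by
    rw [measureReal_def, h] at hhalf
    norm_num at hhalf
  have hcond : IsProbabilityMeasure (ProbabilityTheory.cond ν B) :=
    ProbabilityTheory.cond_isProbabilityMeasure hB0
  refine ⟨(ProbabilityTheory.cond ν B).map (fun u => u + a), ?_,
    smul_map_cond_pi_studentMeasure_le hM hτ hc hπ hπprob a ha, fun L hL v hv => ?_⟩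
  · exact Measure.isProbabilityMeasure_map (measurable_add_const a).aemeasurable
  obtain ⟨hmem, hsq⟩ := integral_sq_sum_mul_pi_studentMeasure_le hτ v hv
  rw [← hν] at hmem hsq
  have hcs : ∀ f : (Fin M → ℝ) → ℝ, Integrable f ν →
      Integrable f (ProbabilityTheory.cond ν B) := fun f hf => by
    rw [ProbabilityTheory.cond]
    exact hf.restrict.smul_measure (ENNReal.inv_ne_top.2 hB0)
  have hi1 := hcs _ (hmem.integrable (by norm_num)).abs
  have hi2 := hcs _ hmem.integrable_sq
  have hmeas : Measurable fun l : Fin M → ℝ => |∑ j, (l j - a j) * v j| := by fun_prop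
  rw [integrable_map_measure hmeas.aestronglyMeasurable (measurable_add_const a).aemeasurable,
    integral_map (measurable_add_const a).aemeasurable hmeas.aestronglyMeasurable]
  simp only [Function.comp_def, Pi.add_apply, add_sub_cancel_right]
  refine ⟨hi1, ?_⟩
  have hM' : (0 : ℝ) < M := by exact_mod_cast hM
  set s : ℝ := τ * L * Real.sqrt M with hs
  have hs0 : 0 < s := by positivity
  have hss : M * (τ ^ 2 * L ^ 2) = s ^ 2 := by
    rw [hs, mul_pow, mul_pow, Real.sq_sqrt hM'.le]; ring
  have hsq' : ∫ u, (∑ j, u j * v j) ^ 2 ∂(ProbabilityTheory.cond ν B) ≤ 2 * s ^ 2 := by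
    rw [ProbabilityTheory.cond, integral_smul_measure, ENNReal.toReal_inv, smul_eq_mul]
    have h1 : ∫ u in B, (∑ j, u j * v j) ^ 2 ∂ν ≤ s ^ 2 := by
      rw [← hss]
      exact (setIntegral_le_integral hmem.integrable_sq
        (Filter.Eventually.of_forall fun u => sq_nonneg _)).trans hsq
    have h2 : (ν B).toReal⁻¹ ≤ 2 := by
      rw [inv_le_comm₀ (by rw [measureReal_def] at hhalf; linarith) (by norm_num)]
      rw [measureReal_def] at hhalf; linarith
    exact mul_le_mul h2 h1 (integral_nonneg fun u => sq_nonneg _) (by norm_num)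
  calc ∫ u, |∑ j, u j * v j| ∂(ProbabilityTheory.cond ν B)
      ≤ ∫ u, ((2 * s)⁻¹ * (∑ j, u j * v j) ^ 2 + s / 2) ∂(ProbabilityTheory.cond ν B) := by
        refine integral_mono hi1 ((hi2.const_mul _).add (integrable_const _)) fun u => ?_
        obtain ⟨x, hx⟩ : ∃ x, x = ∑ j, u j * v j := ⟨_, rfl⟩
        simp only [← hx]
        have h : (2 * s)⁻¹ * x ^ 2 + s / 2 - |x| = (2 * s)⁻¹ * (|x| - s) ^ 2 := by
          field_simp
          rw [← sq_abs x]
          ring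
        have : 0 ≤ (2 * s)⁻¹ * (|x| - s) ^ 2 := by positivity
        linarith
    _ ≤ (2 * s)⁻¹ * (2 * s ^ 2) + s / 2 := by
        rw [integral_add (hi2.const_mul _) (integrable_const _), integral_const_mul]
        simp only [integral_const, probReal_univ, smul_eq_mul, one_mul]
        gcongr
    _ = 3 / 2 * s := by field_simp; ring
    _ ≤ 4 * τ * L * Real.sqrt M := by rw [hs] at hs0 ⊢; linarith

lemma exp_neg_le_quadratic {x : ℝ} (hx : 0 ≤ x) : Real.exp (-x) ≤ 1 - x + x ^ 2 / 2 := by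
  rw [Real.exp_neg, inv_le_iff_one_le_mul₀ (Real.exp_pos x)]
  have h := Real.quadratic_le_exp_of_nonneg hx
  have h0 : 0 ≤ 1 - x + x ^ 2 / 2 := by nlinarith [sq_nonneg (x - 1)]
  nlinarith [mul_le_mul_of_nonneg_left h h0, sq_nonneg (x ^ 2)]

/-- The unnormalized Gibbs weight of the parameter `l` given the observations `ζ i`, `i ∈ s`. -/
noncomputable def gibbsWeight {ι Z Λ : Type*} (β : ℝ) (Q : Z → Λ → ℝ) (s : Finset ι) (ζ : ι → Z)
    (l : Λ) : ℝ :=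
  Real.exp (-(∑ i ∈ s, Q (ζ i) l) / β)

/-- The normalizing constant of the Gibbs weights with respect to the prior `π`. -/
noncomputable def gibbsPartition {ι Z Λ : Type*} [MeasurableSpace Λ] (π : Measure Λ) (β : ℝ)
    (Q : Z → Λ → ℝ) (s : Finset ι) (ζ : ι → Z) : ℝ :=
  ∫ l, gibbsWeight β Q s ζ l ∂π

/-- The loss at `w` averaged over the Gibbs posterior. -/
noncomputable def gibbsLoss {ι Z Λ : Type*} [MeasurableSpace Λ] (π : Measure Λ) (β : ℝ)
    (Q : Z → Λ → ℝ) (s : Finset ι) (ζ : ι → Z) (w : Z) : ℝ :=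
  ∫ l, gibbsWeight β Q s ζ l / gibbsPartition π β Q s ζ * Q w l ∂π

lemma gibbsWeight_pos {ι Z Λ : Type*} {β : ℝ} {Q : Z → Λ → ℝ} (s : Finset ι)
    (ζ : ι → Z) (l : Λ) : 0 < gibbsWeight β Q s ζ l :=
  Real.exp_pos _

lemma gibbsWeight_le_one {ι Z Λ : Type*} {β : ℝ} {Q : Z → Λ → ℝ} (hβ : 0 < β) (hQ0 : ∀ z l, 0 ≤ Q z l)
    (s : Finset ι)
    (ζ : ι → Z) (l : Λ) : gibbsWeight β Q s ζ l ≤ 1 := by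
  rw [gibbsWeight, Real.exp_le_one_iff]
  exact div_nonpos_of_nonpos_of_nonneg
    (neg_nonpos.2 (Finset.sum_nonneg fun i _ => hQ0 _ _)) hβ.le

lemma gibbsWeight_comp_succAbove {Z Λ : Type*} {β : ℝ} {Q : Z → Λ → ℝ} {n : ℕ}
    (m : Fin (n + 1)) (ζ : Fin (n + 1) → Z) (l : Λ) :
    gibbsWeight β Q (Finset.univ.filter fun i : Fin n => (i : ℕ) < m)
      (fun i => ζ (m.succAbove i)) l =
    gibbsWeight β Q (Finset.univ.filter fun i : Fin (n + 1) => (i : ℕ) < m) ζ l := by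
  have hiff : ∀ i : Fin n, ((m.succAbove i : Fin (n + 1)) : ℕ) < m ↔ (i : ℕ) < m := by
    intro i
    rcases lt_or_ge i.castSucc m with h | h
    · rw [Fin.succAbove_of_castSucc_lt _ _ h]; simp
    · rw [Fin.succAbove_of_le_castSucc _ _ h]
      have : (m : ℕ) ≤ i := h
      simp only [Fin.val_succ]
      omega
  unfold gibbsWeight
  rw [Finset.sum_filter, Finset.sum_filter, Fin.sum_univ_succAbove _ m]
  simp [hiff]

lemma integrable_of_smul_le {Λ : Type*} [MeasurableSpace Λ] {π : Measure Λ} {b κ : ℝ} (hκ : 0 < κ)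
    {ρ : Measure Λ} [IsProbabilityMeasure ρ] (hρ : ENNReal.ofReal κ • ρ ≤ π) {f : Λ → ℝ}
    (hf : Measurable f) (hf0 : ∀ l, 0 ≤ f l) (hfb : ∀ᵐ l ∂π, f l ≤ b) :
    (∀ᵐ l ∂ρ, f l ≤ b) ∧ Integrable f ρ := by
  have hac : ρ ≪ π := by
    refine Measure.AbsolutelyContinuous.trans ?_ (Measure.absolutelyContinuous_of_le hρ)
    exact Measure.absolutelyContinuous_smul (ENNReal.ofReal_pos.2 hκ).ne'
  have hb : ∀ᵐ l ∂ρ, f l ≤ b := hac.ae_le hfb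
  refine ⟨hb, Integrable.of_bound hf.aestronglyMeasurable b (hb.mono fun l hl => ?_)⟩
  rwa [Real.norm_of_nonneg (hf0 l)]

section Gibbs

variable {ι Z Λ : Type*} [MeasurableSpace Z] [MeasurableSpace Λ] {π : Measure Λ}
  [IsProbabilityMeasure π] {β b : ℝ} {Q : Z → Λ → ℝ}

lemma measurable_gibbsWeight (hQ : Measurable (Function.uncurry Q)) (s : Finset ι) :
    Measurable fun p : (ι → Z) × Λ => gibbsWeight β Q s p.1 p.2 := by
  unfold gibbsWeight
  have : ∀ i, Measurable fun p : (ι → Z) × Λ => Q (p.1 i) p.2 := fun i => by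
    have h : Measurable fun p : (ι → Z) × Λ => (p.1 i, p.2) := by fun_prop
    exact hQ.comp h
  fun_prop

lemma integrable_gibbsWeight (hβ : 0 < β) (hQ : Measurable (Function.uncurry Q))
    (hQ0 : ∀ z l, 0 ≤ Q z l) (ν : Measure Λ) [IsFiniteMeasure ν] (s : Finset ι) (ζ : ι → Z) :
    Integrable (gibbsWeight β Q s ζ) ν := by
  refine Integrable.of_bound
    ((measurable_gibbsWeight hQ s).comp measurable_prodMk_left).aestronglyMeasurable 1 ?_
  refine Filter.Eventually.of_forall fun l => ?_
  rw [Real.norm_of_nonneg (gibbsWeight_pos s ζ l).le]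
  exact gibbsWeight_le_one hβ hQ0 s ζ l

lemma gibbsPartition_pos (hβ : 0 < β) (hQ : Measurable (Function.uncurry Q))
    (hQ0 : ∀ z l, 0 ≤ Q z l) (s : Finset ι) (ζ : ι → Z) : 0 < gibbsPartition π β Q s ζ :=
  integral_exp_pos (integrable_gibbsWeight hβ hQ hQ0 π s ζ)

lemma measurable_gibbsPartition (hQ : Measurable (Function.uncurry Q)) (s : Finset ι) :
    Measurable (gibbsPartition π β Q s) :=
  ((measurable_gibbsWeight hQ s).stronglyMeasurable.integral_prod_right').measurable

lemma measurable_gibbsLoss (hQ : Measurable (Function.uncurry Q)) (s : Finset ι) :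
    Measurable fun p : (ι → Z) × Z => gibbsLoss π β Q s p.1 p.2 := by
  have h : Measurable fun q : ((ι → Z) × Z) × Λ =>
      gibbsWeight β Q s q.1.1 q.2 / gibbsPartition π β Q s q.1.1 * Q q.1.2 q.2 := by
    refine Measurable.mul (Measurable.div ?_ ?_) ?_
    · exact (measurable_gibbsWeight hQ s).comp
        ((measurable_fst.comp measurable_fst).prodMk measurable_snd)
    · exact (measurable_gibbsPartition hQ s).comp (measurable_fst.comp measurable_fst)
    · exact hQ.comp ((measurable_snd.comp measurable_fst).prodMk measurable_snd)
  exact (h.stronglyMeasurable.integral_prod_right').measurable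

lemma integral_gibbsWeight_div (hβ : 0 < β) (hQ : Measurable (Function.uncurry Q))
    (hQ0 : ∀ z l, 0 ≤ Q z l) (s : Finset ι) (ζ : ι → Z) :
    ∫ l, gibbsWeight β Q s ζ l / gibbsPartition π β Q s ζ ∂π = 1 := by
  rw [integral_div]
  exact div_self (gibbsPartition_pos hβ hQ hQ0 s ζ).ne'

lemma integrable_gibbsWeight_mul (hβ : 0 < β) (hQ : Measurable (Function.uncurry Q))
    (hQ0 : ∀ z l, 0 ≤ Q z l) (s : Finset ι) (ζ : ι → Z) {f : Λ → ℝ} (hf : Measurable f)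
    (hfb : ∀ᵐ l ∂π, |f l| ≤ b) :
    Integrable (fun l => gibbsWeight β Q s ζ l * f l) π :=
  (integrable_gibbsWeight hβ hQ hQ0 π s ζ).mul_bdd hf.aestronglyMeasurable hfb

lemma integrable_gibbsWeight_div_mul (hβ : 0 < β) (hQ : Measurable (Function.uncurry Q))
    (hQ0 : ∀ z l, 0 ≤ Q z l) (s : Finset ι) (ζ : ι → Z) {f : Λ → ℝ} (hf : Measurable f)
    (hfb : ∀ᵐ l ∂π, |f l| ≤ b) :
    Integrable (fun l => gibbsWeight β Q s ζ l / gibbsPartition π β Q s ζ * f l) π :=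
  ((integrable_gibbsWeight hβ hQ hQ0 π s ζ).div_const _).mul_bdd hf.aestronglyMeasurable hfb

lemma gibbsLoss_nonneg (hβ : 0 < β) (hQ : Measurable (Function.uncurry Q))
    (hQ0 : ∀ z l, 0 ≤ Q z l) (s : Finset ι) (ζ : ι → Z) (w : Z) :
    0 ≤ gibbsLoss π β Q s ζ w :=
  integral_nonneg fun l => mul_nonneg (div_nonneg (gibbsWeight_pos s ζ l).le
    (gibbsPartition_pos hβ hQ hQ0 s ζ).le) (hQ0 w l)

lemma gibbsLoss_le (hβ : 0 < β) (hQ : Measurable (Function.uncurry Q))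
    (hQ0 : ∀ z l, 0 ≤ Q z l) (s : Finset ι) (ζ : ι → Z) {w : Z} (hw : ∀ᵐ l ∂π, Q w l ≤ b) :
    gibbsLoss π β Q s ζ w ≤ b := by
  have hQw : Measurable (Q w) := hQ.comp measurable_prodMk_left
  calc gibbsLoss π β Q s ζ w
      ≤ ∫ l, gibbsWeight β Q s ζ l / gibbsPartition π β Q s ζ * b ∂π := by
        refine integral_mono_ae (integrable_gibbsWeight_div_mul hβ hQ hQ0 s ζ hQw
          (hw.mono fun l hl => by rwa [abs_of_nonneg (hQ0 w l)]))
          (((integrable_gibbsWeight hβ hQ hQ0 π s ζ).div_const _).mul_const _) ?_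
        filter_upwards [hw] with l hl
        exact mul_le_mul_of_nonneg_left hl (div_nonneg (gibbsWeight_pos s ζ l).le
          (gibbsPartition_pos hβ hQ hQ0 s ζ).le)
    _ = b := by rw [integral_mul_const, integral_gibbsWeight_div hβ hQ hQ0, one_mul]

/-- Mixability of a bounded loss: the posterior loss at a new observation is controlled by the
decrease of the log-partition function. -/
lemma gibbsLoss_le_log_sub_log [DecidableEq ι] (hβ : 0 < β)
    (hQ : Measurable (Function.uncurry Q)) (hQ0 : ∀ z l, 0 ≤ Q z l) {s : Finset ι} {i : ι}
    (hi : i ∉ s) (ζ : ι → Z) (hw : ∀ᵐ l ∂π, Q (ζ i) l ≤ b) :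
    gibbsLoss π β Q s ζ (ζ i) ≤ b ^ 2 / (2 * β) + β * (Real.log (gibbsPartition π β Q s ζ) -
      Real.log (gibbsPartition π β Q (insert i s) ζ)) := by
  have hQw : Measurable (Q (ζ i)) := hQ.comp measurable_prodMk_left
  have hD := gibbsPartition_pos (π := π) hβ hQ hQ0 s ζ
  have hD' := gibbsPartition_pos (π := π) hβ hQ hQ0 (insert i s) ζ
  have hint := integrable_gibbsWeight_mul (π := π) hβ hQ hQ0 s ζ hQw
    (hw.mono fun l hl => by rwa [abs_of_nonneg (hQ0 (ζ i) l)])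
  have hint1 := integrable_gibbsWeight hβ hQ hQ0 π s ζ
  have hloss : gibbsLoss π β Q s ζ (ζ i) =
      (∫ l, gibbsWeight β Q s ζ l * Q (ζ i) l ∂π) / gibbsPartition π β Q s ζ := by
    rw [gibbsLoss, ← integral_div]
    exact integral_congr_ae (Filter.Eventually.of_forall fun l => div_mul_eq_mul_div _ _ _)
  have hle : gibbsPartition π β Q (insert i s) ζ ≤
      (1 + b ^ 2 / (2 * β ^ 2)) * gibbsPartition π β Q s ζ -
        β⁻¹ * ∫ l, gibbsWeight β Q s ζ l * Q (ζ i) l ∂π := by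
    rw [gibbsPartition, gibbsPartition, ← integral_const_mul, ← integral_const_mul,
      ← integral_sub (hint1.const_mul _) (hint.const_mul _)]
    refine integral_mono_ae (integrable_gibbsWeight hβ hQ hQ0 π _ ζ)
      ((hint1.const_mul _).sub (hint.const_mul _)) ?_
    filter_upwards [hw] with l hl
    have hq := hQ0 (ζ i) l
    have hsplit : gibbsWeight β Q (insert i s) ζ l =
        gibbsWeight β Q s ζ l * Real.exp (-(Q (ζ i) l / β)) := by
      rw [gibbsWeight, gibbsWeight, Finset.sum_insert hi, ← Real.exp_add]
      congr 1
      ring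
    have hexp := exp_neg_le_quadratic (x := Q (ζ i) l / β) (by positivity)
    have hsq : (Q (ζ i) l / β) ^ 2 / 2 ≤ b ^ 2 / (2 * β ^ 2) := by
      rw [div_pow, div_div, mul_comm (β ^ 2)]
      gcongr
    rw [hsplit]
    calc gibbsWeight β Q s ζ l * Real.exp (-(Q (ζ i) l / β))
        ≤ gibbsWeight β Q s ζ l * (1 - Q (ζ i) l / β + b ^ 2 / (2 * β ^ 2)) :=
          mul_le_mul_of_nonneg_left (by linarith) (gibbsWeight_pos s ζ l).le
      _ = _ := by ring
  have hlog := Real.log_le_sub_one_of_pos (div_pos hD' hD)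
  rw [Real.log_div hD'.ne' hD.ne'] at hlog
  have hratio : gibbsPartition π β Q (insert i s) ζ / gibbsPartition π β Q s ζ ≤
      1 + b ^ 2 / (2 * β ^ 2) - β⁻¹ * gibbsLoss π β Q s ζ (ζ i) := by
    rw [div_le_iff₀ hD, hloss]
    refine hle.trans (le_of_eq ?_)
    field_simp
  have hfin : β⁻¹ * gibbsLoss π β Q s ζ (ζ i) ≤ b ^ 2 / (2 * β ^ 2) +
      (Real.log (gibbsPartition π β Q s ζ) -
        Real.log (gibbsPartition π β Q (insert i s) ζ)) := by linarith
  calc gibbsLoss π β Q s ζ (ζ i) = β * (β⁻¹ * gibbsLoss π β Q s ζ (ζ i)) := by field_simp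
    _ ≤ β * (b ^ 2 / (2 * β ^ 2) + (Real.log (gibbsPartition π β Q s ζ) -
        Real.log (gibbsPartition π β Q (insert i s) ζ))) := mul_le_mul_of_nonneg_left hfin hβ.le
    _ = _ := by field_simp

lemma abs_log_gibbsPartition_le (hβ : 0 < β) (hQ : Measurable (Function.uncurry Q))
    (hQ0 : ∀ z l, 0 ≤ Q z l) (s : Finset ι) {ζ : ι → Z}
    (hζ : ∀ i ∈ s, ∀ᵐ l ∂π, Q (ζ i) l ≤ b) :
    |Real.log (gibbsPartition π β Q s ζ)| ≤ s.card * b / β := by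
  have hD := gibbsPartition_pos (π := π) hβ hQ hQ0 s ζ
  have hint1 := integrable_gibbsWeight hβ hQ hQ0 π s ζ
  have hup : gibbsPartition π β Q s ζ ≤ 1 := by
    calc gibbsPartition π β Q s ζ ≤ ∫ _, (1 : ℝ) ∂π :=
          integral_mono hint1 (integrable_const _) (gibbsWeight_le_one hβ hQ0 s ζ)
      _ = 1 := by simp
  have hlow : Real.exp (-(s.card * b / β)) ≤ gibbsPartition π β Q s ζ := by
    calc Real.exp (-(s.card * b / β)) = ∫ _, Real.exp (-(s.card * b / β)) ∂π := by simp
      _ ≤ gibbsPartition π β Q s ζ := by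
        refine integral_mono_ae (integrable_const _) hint1 ?_
        have hall : ∀ᵐ l ∂π, ∀ i ∈ s, Q (ζ i) l ≤ b := (ae_ball_iff s.countable_toSet).2 hζ
        filter_upwards [hall] with l hl
        refine Real.exp_le_exp.2 ?_
        rw [← neg_div]
        gcongr
        simpa using Finset.sum_le_card_nsmul s _ b hl
  rw [abs_of_nonpos (Real.log_nonpos hD.le hup)]
  have := Real.log_le_log (Real.exp_pos _) hlow
  rw [Real.log_exp] at this
  linarith

/-- Variational lower bound for the log-partition function. -/
lemma log_sub_integral_le_log_gibbsPartition (hβ : 0 < β)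
    (hQ : Measurable (Function.uncurry Q)) (hQ0 : ∀ z l, 0 ≤ Q z l) {κ : ℝ} (hκ : 0 < κ)
    {ρ : Measure Λ} [IsProbabilityMeasure ρ] (hρ : ENNReal.ofReal κ • ρ ≤ π) (s : Finset ι)
    {ζ : ι → Z} (hζ : ∀ i ∈ s, Integrable (Q (ζ i)) ρ) :
    Real.log κ - (∑ i ∈ s, ∫ l, Q (ζ i) l ∂ρ) / β ≤ Real.log (gibbsPartition π β Q s ζ) := by
  have hintπ := integrable_gibbsWeight hβ hQ hQ0 π s ζ
  have hintρ := integrable_gibbsWeight hβ hQ hQ0 ρ s ζ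
  have hmono : κ * ∫ l, gibbsWeight β Q s ζ l ∂ρ ≤ gibbsPartition π β Q s ζ := by
    have := integral_mono_measure hρ
      (Filter.Eventually.of_forall fun l => (gibbsWeight_pos s ζ l).le) hintπ
    rwa [integral_smul_measure, ENNReal.toReal_ofReal hκ.le, smul_eq_mul] at this
  have hsum : Integrable (fun l => -(∑ i ∈ s, Q (ζ i) l) / β) ρ :=
    ((integrable_finsetSum s hζ).neg).div_const β
  have hjensen := convexOn_exp.map_integral_le (μ := ρ)
    (f := fun l => -(∑ i ∈ s, Q (ζ i) l) / β) Real.continuous_exp.continuousOn isClosed_univ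
    (Filter.Eventually.of_forall fun _ => Set.mem_univ _) hsum hintρ
  have heq : ∫ l, -(∑ i ∈ s, Q (ζ i) l) / β ∂ρ = -(∑ i ∈ s, ∫ l, Q (ζ i) l ∂ρ) / β := by
    rw [integral_div, integral_neg, integral_finsetSum s hζ]
  rw [heq] at hjensen
  have h := Real.log_le_log (mul_pos hκ (Real.exp_pos _))
    ((mul_le_mul_of_nonneg_left hjensen hκ.le).trans hmono)
  rw [Real.log_mul hκ.ne' (Real.exp_pos _).ne', Real.log_exp, neg_div] at h
  linarith

lemma integrable_log_gibbsPartition [Fintype ι] (hβ : 0 < β)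
    (hQ : Measurable (Function.uncurry Q)) (hQ0 : ∀ z l, 0 ≤ Q z l) {P : Measure Z}
    [IsProbabilityMeasure P] (hQb : ∀ᵐ z ∂P, ∀ᵐ l ∂π, Q z l ≤ b) (s : Finset ι) :
    Integrable (fun ζ => Real.log (gibbsPartition π β Q s ζ)) (Measure.pi fun _ : ι => P) := by
  refine Integrable.of_bound
    (measurable_gibbsPartition hQ s).log.aestronglyMeasurable (s.card * b / β) ?_
  have hgood : ∀ᵐ ζ ∂(Measure.pi fun _ : ι => P), ∀ i, ∀ᵐ l ∂π, Q (ζ i) l ≤ b :=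
    ae_all_iff.2 fun i => (measurePreserving_eval (fun _ : ι => P) i).quasiMeasurePreserving.ae hQb
  filter_upwards [hgood] with ζ hζ
  exact abs_log_gibbsPartition_le hβ hQ hQ0 s fun i _ => hζ i

variable {P : Measure Z} [IsProbabilityMeasure P]

lemma integrable_gibbsLoss_prod [Fintype ι] (hβ : 0 < β)
    (hQ : Measurable (Function.uncurry Q)) (hQ0 : ∀ z l, 0 ≤ Q z l)
    (hQb : ∀ᵐ z ∂P, ∀ᵐ l ∂π, Q z l ≤ b) (s : Finset ι) :
    Integrable (fun p : (ι → Z) × Z => gibbsLoss π β Q s p.1 p.2)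
      ((Measure.pi fun _ : ι => P).prod P) := by
  refine Integrable.of_bound (measurable_gibbsLoss hQ s).aestronglyMeasurable b ?_
  filter_upwards [Measure.quasiMeasurePreserving_snd.ae hQb] with p hp
  rw [Real.norm_of_nonneg (gibbsLoss_nonneg hβ hQ hQ0 _ _ _)]
  exact gibbsLoss_le hβ hQ hQ0 _ _ hp

lemma integral_gibbsLoss_le {n : ℕ} (hβ : 0 < β)
    (hQ : Measurable (Function.uncurry Q)) (hQ0 : ∀ z l, 0 ≤ Q z l)
    (hQb : ∀ᵐ z ∂P, ∀ᵐ l ∂π, Q z l ≤ b) {m : ℕ} (hm : m < n + 1) :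
    ∫ p, gibbsLoss π β Q (Finset.univ.filter fun i : Fin n => (i : ℕ) < m) p.1 p.2
      ∂((Measure.pi fun _ : Fin n => P).prod P) ≤ b ^ 2 / (2 * β) +
        (β * ∫ ζ, Real.log (gibbsPartition π β Q
            (Finset.univ.filter fun i : Fin (n + 1) => (i : ℕ) < m) ζ)
          ∂(Measure.pi fun _ : Fin (n + 1) => P) -
        β * ∫ ζ, Real.log (gibbsPartition π β Q
            (Finset.univ.filter fun i : Fin (n + 1) => (i : ℕ) < m + 1) ζ)
          ∂(Measure.pi fun _ : Fin (n + 1) => P)) := by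
  set i₀ : Fin (n + 1) := ⟨m, hm⟩ with hi₀
  have hmp := measurePreserving_piFinSuccAbove (fun _ : Fin (n + 1) => P) i₀
  have hswap := (Measure.measurePreserving_swap (μ := P) (ν := Measure.pi fun _ : Fin n => P))
  have hcomp := hswap.comp hmp
  have hint := integrable_gibbsLoss_prod (ι := Fin n) (P := P) hβ hQ hQ0 hQb
    (Finset.univ.filter fun i : Fin n => (i : ℕ) < m)
  have heq : ∀ ζ : Fin (n + 1) → Z,
      gibbsLoss π β Q (Finset.univ.filter fun i : Fin n => (i : ℕ) < m)
        (fun i => ζ (i₀.succAbove i)) (ζ i₀) =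
      gibbsLoss π β Q (Finset.univ.filter fun i : Fin (n + 1) => (i : ℕ) < m) ζ (ζ i₀) := by
    intro ζ
    have hw := fun l => gibbsWeight_comp_succAbove (β := β) (Q := Q) i₀ ζ l
    unfold gibbsLoss gibbsPartition
    simp only [hi₀] at hw ⊢
    simp only [hw]
  have hint' : Integrable (fun ζ : Fin (n + 1) → Z =>
      gibbsLoss π β Q (Finset.univ.filter fun i : Fin (n + 1) => (i : ℕ) < m) ζ (ζ i₀))
      (Measure.pi fun _ : Fin (n + 1) => P) := by
    refine (hcomp.integrable_comp_of_integrable hint).congr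
      (Filter.Eventually.of_forall fun ζ => heq ζ)
  have hmap : ∫ p, gibbsLoss π β Q (Finset.univ.filter fun i : Fin n => (i : ℕ) < m) p.1 p.2
      ∂((Measure.pi fun _ : Fin n => P).prod P) =
      ∫ ζ, gibbsLoss π β Q (Finset.univ.filter fun i : Fin (n + 1) => (i : ℕ) < m) ζ (ζ i₀)
        ∂(Measure.pi fun _ : Fin (n + 1) => P) := by
    rw [← hcomp.map_eq, integral_map hcomp.measurable.aemeasurable
      (measurable_gibbsLoss hQ _).aestronglyMeasurable]
    exact integral_congr_ae (Filter.Eventually.of_forall fun ζ => heq ζ)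
  have hins : insert i₀ (Finset.univ.filter fun i : Fin (n + 1) => (i : ℕ) < m) =
      Finset.univ.filter fun i : Fin (n + 1) => (i : ℕ) < m + 1 := by
    ext i
    simp only [Finset.mem_insert, Finset.mem_filter, Finset.mem_univ, true_and, hi₀, Fin.ext_iff]
    omega
  have hl1 := integrable_log_gibbsPartition (ι := Fin (n + 1)) hβ hQ hQ0 hQb
    (Finset.univ.filter fun i : Fin (n + 1) => (i : ℕ) < m)
  have hl2 := integrable_log_gibbsPartition (ι := Fin (n + 1)) hβ hQ hQ0 hQb
    (Finset.univ.filter fun i : Fin (n + 1) => (i : ℕ) < m + 1)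
  have hbound : ∀ᵐ ζ ∂(Measure.pi fun _ : Fin (n + 1) => P),
      gibbsLoss π β Q (Finset.univ.filter fun i : Fin (n + 1) => (i : ℕ) < m) ζ (ζ i₀) ≤
        b ^ 2 / (2 * β) + β * (Real.log (gibbsPartition π β Q
            (Finset.univ.filter fun i : Fin (n + 1) => (i : ℕ) < m) ζ) -
          Real.log (gibbsPartition π β Q
            (Finset.univ.filter fun i : Fin (n + 1) => (i : ℕ) < m + 1) ζ)) := by
    have hgood := (measurePreserving_eval (fun _ : Fin (n + 1) => P)
      i₀).quasiMeasurePreserving.ae hQb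
    filter_upwards [hgood] with ζ hζ
    have := gibbsLoss_le_log_sub_log (π := π) hβ hQ hQ0
      (s := Finset.univ.filter fun i : Fin (n + 1) => (i : ℕ) < m) (i := i₀) (by simp [hi₀]) ζ hζ
    rwa [hins] at this
  rw [hmap]
  have hsub : Integrable (fun ζ : Fin (n + 1) → Z => β * (Real.log (gibbsPartition π β Q
            (Finset.univ.filter fun i : Fin (n + 1) => (i : ℕ) < m) ζ) -
          Real.log (gibbsPartition π β Q
            (Finset.univ.filter fun i : Fin (n + 1) => (i : ℕ) < m + 1) ζ)))
      (Measure.pi fun _ : Fin (n + 1) => P) := (hl1.sub hl2).const_mul β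
  refine (integral_mono_ae hint'
    ((integrable_const _).add hsub) hbound).trans (le_of_eq ?_)
  simp only [Pi.add_apply]
  rw [integral_add (integrable_const _) hsub, integral_const_mul, integral_sub hl1 hl2]
  simp [mul_sub]

/-- PAC-Bayesian bound for the mirror averaging scheme with a bounded loss. -/
theorem integral_average_gibbsLoss_le {n : ℕ} (hβ : 0 < β)
    (hQ : Measurable (Function.uncurry Q)) (hQ0 : ∀ z l, 0 ≤ Q z l)
    (hQb : ∀ᵐ z ∂P, ∀ᵐ l ∂π, Q z l ≤ b) {κ : ℝ} (hκ : 0 < κ)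
    {ρ : Measure Λ} [IsProbabilityMeasure ρ] (hρ : ENNReal.ofReal κ • ρ ≤ π) :
    ∫ p, ((n : ℝ) + 1)⁻¹ * ∑ m ∈ Finset.range (n + 1),
        gibbsLoss π β Q (Finset.univ.filter fun i : Fin n => (i : ℕ) < m) p.1 p.2
      ∂((Measure.pi fun _ : Fin n => P).prod P) ≤
    b ^ 2 / (2 * β) - β * Real.log κ / (n + 1) + ∫ w, ∫ l, Q w l ∂ρ ∂P := by
  set F : ℕ → ℝ := fun m => β * ∫ ζ, Real.log (gibbsPartition π β Q
      (Finset.univ.filter fun i : Fin (n + 1) => (i : ℕ) < m) ζ)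
    ∂(Measure.pi fun _ : Fin (n + 1) => P) with hF
  have hn : (0 : ℝ) < n + 1 := by positivity
  have hslice : ∀ w, Measurable (Q w) := fun w => hQ.comp measurable_prodMk_left
  have hQρ : ∀ᵐ w ∂P, (∀ᵐ l ∂ρ, Q w l ≤ b) ∧ Integrable (Q w) ρ :=
    hQb.mono fun w hw => integrable_of_smul_le hκ hρ (hslice w) (hQ0 w) hw
  have hmeas : Measurable fun w => ∫ l, Q w l ∂ρ :=
    (hQ.stronglyMeasurable.integral_prod_right').measurable
  have hQint : Integrable (fun w => ∫ l, Q w l ∂ρ) P := by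
    refine Integrable.of_bound hmeas.aestronglyMeasurable b (hQρ.mono fun w hw => ?_)
    rw [Real.norm_of_nonneg (integral_nonneg (hQ0 w))]
    calc ∫ l, Q w l ∂ρ ≤ ∫ _, b ∂ρ := integral_mono_ae hw.2 (integrable_const _) hw.1
      _ = b := by simp
  have hF0 : F 0 = 0 := by simp [hF, gibbsPartition, gibbsWeight]
  have hFn : β * Real.log κ - (n + 1) * ∫ w, ∫ l, Q w l ∂ρ ∂P ≤ F (n + 1) := by
    have huniv : (Finset.univ.filter fun i : Fin (n + 1) => (i : ℕ) < n + 1) = Finset.univ :=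
      Finset.filter_true_of_mem fun i _ => i.2
    simp only [hF, huniv]
    have hi : ∀ i : Fin (n + 1), Integrable (fun ζ : Fin (n + 1) → Z => ∫ l, Q (ζ i) l ∂ρ)
        (Measure.pi fun _ : Fin (n + 1) => P) := fun i =>
      integrable_comp_eval (μ := fun _ : Fin (n + 1) => P) (i := i) hQint
    have hsum : Integrable (fun ζ : Fin (n + 1) → Z => (∑ i, ∫ l, Q (ζ i) l ∂ρ) / β)
        (Measure.pi fun _ : Fin (n + 1) => P) :=
      (integrable_finsetSum _ fun i _ => hi i).div_const β
    have hle : ∫ ζ, (Real.log κ - (∑ i, ∫ l, Q (ζ i) l ∂ρ) / β)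
          ∂(Measure.pi fun _ : Fin (n + 1) => P) ≤
        ∫ ζ, Real.log (gibbsPartition π β Q Finset.univ ζ)
          ∂(Measure.pi fun _ : Fin (n + 1) => P) := by
      refine integral_mono_ae ((integrable_const _).sub hsum)
        (integrable_log_gibbsPartition hβ hQ hQ0 hQb _) ?_
      have hgood : ∀ᵐ ζ ∂(Measure.pi fun _ : Fin (n + 1) => P), ∀ i, Integrable (Q (ζ i)) ρ :=
        ae_all_iff.2 fun i => (measurePreserving_eval (fun _ : Fin (n + 1) => P)
          i).quasiMeasurePreserving.ae (hQρ.mono fun w hw => hw.2)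
      filter_upwards [hgood] with ζ hζ
      exact log_sub_integral_le_log_gibbsPartition hβ hQ hQ0 hκ hρ _ fun i _ => hζ i
    rw [integral_sub (integrable_const _) hsum, integral_div,
      integral_finsetSum _ fun i _ => hi i] at hle
    have hcoord : ∀ i : Fin (n + 1), ∫ ζ, ∫ l, Q (ζ i) l ∂ρ ∂(Measure.pi fun _ : Fin (n + 1) => P)
        = ∫ w, ∫ l, Q w l ∂ρ ∂P := fun i =>
      integral_comp_eval (μ := fun _ : Fin (n + 1) => P) (i := i)
        (f := fun w => ∫ l, Q w l ∂ρ) hmeas.aestronglyMeasurable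
    simp only [hcoord, integral_const, probReal_univ, one_smul, Finset.sum_const,
      Finset.card_univ, Fintype.card_fin, nsmul_eq_mul, Nat.cast_add, Nat.cast_one] at hle
    have := mul_le_mul_of_nonneg_left hle hβ.le
    rwa [mul_sub, mul_div_cancel₀ _ hβ.ne'] at this
  rw [integral_const_mul, integral_finsetSum _ fun m _ =>
    integrable_gibbsLoss_prod hβ hQ hQ0 hQb _]
  have hstep := Finset.sum_le_sum fun m (hm : m ∈ Finset.range (n + 1)) =>
    integral_gibbsLoss_le (n := n) hβ hQ hQ0 hQb (Finset.mem_range.1 hm)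
  have htel : ∑ m ∈ Finset.range (n + 1), (b ^ 2 / (2 * β) + (F m - F (m + 1))) =
      (n + 1) * (b ^ 2 / (2 * β)) + (F 0 - F (n + 1)) := by
    rw [Finset.sum_add_distrib, Finset.sum_range_sub']
    simp
  have hfin := hstep.trans (le_of_eq htel)
  calc _ ≤ ((n : ℝ) + 1)⁻¹ * ((n + 1) * (b ^ 2 / (2 * β)) + (F 0 - F (n + 1))) :=
        mul_le_mul_of_nonneg_left hfin (by positivity)
    _ ≤ ((n : ℝ) + 1)⁻¹ * ((n + 1) * (b ^ 2 / (2 * β)) +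
        ((n + 1) * (∫ w, ∫ l, Q w l ∂ρ ∂P) - β * Real.log κ)) := by
        refine mul_le_mul_of_nonneg_left ?_ (by positivity)
        linarith
    _ = _ := by field_simp; ring

lemma measurable_integral_gibbsWeight_div_mul {X : Type*} [MeasurableSpace X]
    (hQ : Measurable (Function.uncurry Q)) (s : Finset ι) {f : X × Λ → ℝ} (hf : Measurable f) :
    Measurable fun q : (ι → Z) × X =>
      ∫ l, gibbsWeight β Q s q.1 l / gibbsPartition π β Q s q.1 * f (q.2, l) ∂π := by
  have hw : Measurable fun q : ((ι → Z) × X) × Λ => gibbsWeight β Q s q.1.1 q.2 :=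
    (measurable_gibbsWeight hQ s).comp
      ((measurable_fst.comp measurable_fst).prodMk measurable_snd)
  have hp : Measurable fun q : ((ι → Z) × X) × Λ => gibbsPartition π β Q s q.1.1 :=
    (measurable_gibbsPartition hQ s).comp (measurable_fst.comp measurable_fst)
  have hf' : Measurable fun q : ((ι → Z) × X) × Λ => f (q.1.2, q.2) :=
    hf.comp ((measurable_snd.comp measurable_fst).prodMk measurable_snd)
  exact ((hw.div hp).mul hf').stronglyMeasurable.integral_prod_right'.measurable

/-- An affine function of the Gibbs posterior mean is controlled by the Gibbs loss, whenever the
loss dominates that affine function. -/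
lemma one_sub_mul_integral_le_gibbsLoss (hβ : 0 < β)
    (hQ : Measurable (Function.uncurry Q)) (hQ0 : ∀ z l, 0 ≤ Q z l) (s : Finset ι) (ζ : ι → Z)
    {f : Λ → ℝ} (hf : Measurable f) {r y : ℝ} (hfr : ∀ᵐ l ∂π, |f l| ≤ r) {w : Z}
    (hw : ∀ᵐ l ∂π, Q w l ≤ b) (hle : ∀ l, 1 - y * f l ≤ Q w l) :
    1 - y * ∫ l, gibbsWeight β Q s ζ l / gibbsPartition π β Q s ζ * f l ∂π ≤
      gibbsLoss π β Q s ζ w := by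
  have hi0 := (integrable_gibbsWeight hβ hQ hQ0 π s ζ).div_const (gibbsPartition π β Q s ζ)
  have hi1 := integrable_gibbsWeight_div_mul hβ hQ hQ0 s ζ hf hfr
  have hi2 := integrable_gibbsWeight_div_mul (π := π) (b := b) hβ hQ hQ0 s ζ
    (f := Q w) (hQ.comp measurable_prodMk_left) (hw.mono fun l hl => by
      rwa [abs_of_nonneg (hQ0 _ _)])
  rw [gibbsLoss, ← integral_gibbsWeight_div (π := π) hβ hQ hQ0 s ζ,
    ← integral_const_mul, ← integral_sub hi0 (hi1.const_mul _)]
  refine integral_mono (hi0.sub (hi1.const_mul _)) hi2 fun l => ?_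
  have h0 : 0 ≤ gibbsWeight β Q s ζ l / gibbsPartition π β Q s ζ :=
    div_nonneg (gibbsWeight_pos s ζ l).le (gibbsPartition_pos hβ hQ hQ0 s ζ).le
  have := mul_le_mul_of_nonneg_left (hle l) h0
  simp only
  linarith

end Gibbs

lemma abs_sum_mul_le {ι : Type*} [Fintype ι] {L r : ℝ} (hL : 0 ≤ L) {l v : ι → ℝ}
    (hl : ∑ j, |l j| ≤ r) (hv : ∀ j, |v j| ≤ L) : |∑ j, l j * v j| ≤ r * L := by
  calc |∑ j, l j * v j| ≤ ∑ j, |l j| * L := by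
        refine (Finset.abs_sum_le_sum_abs _ _).trans (Finset.sum_le_sum fun j _ => ?_)
        rw [abs_mul]
        exact mul_le_mul_of_nonneg_left (hv j) (abs_nonneg _)
    _ ≤ r * L := by
        rw [← Finset.sum_mul]
        exact mul_le_mul_of_nonneg_right hl hL

lemma abs_label_mul {y : ℝ} (hy : y = 1 ∨ y = -1) (t : ℝ) : |y * t| = |t| := by
  rcases hy with rfl | rfl <;> simp

lemma hinge_le {y t r : ℝ} (hy : y = 1 ∨ y = -1) (ht : |t| ≤ r) :
    max (1 - y * t) 0 ≤ 1 + r := by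
  have h0 := abs_nonneg t
  rw [← abs_label_mul hy] at ht h0
  exact max_le (by linarith [neg_abs_le (y * t)]) (by linarith)

lemma hinge_le_hinge_add_abs_sub {y : ℝ} (hy : y = 1 ∨ y = -1) (s t : ℝ) :
    max (1 - y * s) 0 ≤ max (1 - y * t) 0 + |s - t| := by
  have h := abs_label_mul hy (s - t)
  have h0 := abs_nonneg (s - t)
  refine max_le ?_ (add_nonneg (le_max_right _ _) h0)
  have := neg_abs_le (y * (s - t))
  have := le_max_left (1 - y * t) 0
  nlinarith

lemma ae_sum_abs_le_of_sparsityPrior {M : ℕ} {τ R c : ℝ} {π : Measure (Fin M → ℝ)}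
    (hπ : π = volume.withDensity fun l => ENNReal.ofReal
      (if (∑ j, |l j|) ≤ R then c * ∏ j, ((τ ^ 2 + l j ^ 2) ^ 2)⁻¹ else 0)) :
    ∀ᵐ l ∂π, ∑ j, |l j| ≤ R := by
  have hset : MeasurableSet {l : Fin M → ℝ | ∑ j, |l j| ≤ R} :=
    measurableSet_le (by fun_prop) (by fun_prop)
  rw [hπ, ae_withDensity_iff
    ((Measurable.ite hset (by fun_prop) measurable_const).ennreal_ofReal)]
  refine Filter.Eventually.of_forall fun l hl => ?_
  by_contra hcon
  rw [if_neg hcon, ENNReal.ofReal_zero] at hl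
  exact hl rfl

lemma sq_div_le_mul_exp {β b : ℝ} (hβ : 0 < β) (hb : 0 ≤ b) :
    b ^ 2 / (2 * β) ≤ 2 * b ^ 2 / β * Real.exp (b / β) := by
  have h1 : 1 ≤ Real.exp (b / β) := Real.one_le_exp (by positivity)
  have h2 : 0 ≤ b ^ 2 / β := by positivity
  have h3 : b ^ 2 / (2 * β) = b ^ 2 / β / 2 := by rw [div_div, mul_comm]
  have h4 : 2 * b ^ 2 / β = 2 * (b ^ 2 / β) := by ring
  rw [h3, h4]
  nlinarith

lemma neg_mul_log_div_le {ι : Type*} [Fintype ι] {β N : ℝ} (hβ : 0 < β) (hN : 0 < N)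
    {u : ι → ℝ} (hu : ∀ j, 0 < u j) :
    -(β * Real.log (1 / 2 * ∏ j, (u j ^ 4)⁻¹) / N) ≤
      4 * β / N * (∑ j, Real.log (u j)) + β / N := by
  have hlog : -Real.log (1 / 2 * ∏ j, (u j ^ 4)⁻¹) ≤ 4 * (∑ j, Real.log (u j)) + 1 := by
    rw [Real.log_mul (by norm_num) (Finset.prod_pos fun j _ => inv_pos.2 (pow_pos (hu j) 4)).ne',
      Real.log_prod fun j _ => (inv_pos.2 (pow_pos (hu j) 4)).ne']
    simp only [Real.log_inv, Real.log_pow, Finset.sum_neg_distrib, ← Finset.mul_sum, one_div]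
    push_cast
    linarith [Real.log_two_lt_d9]
  calc -(β * Real.log (1 / 2 * ∏ j, (u j ^ 4)⁻¹) / N)
      = β / N * -Real.log (1 / 2 * ∏ j, (u j ^ 4)⁻¹) := by ring
    _ ≤ β / N * (4 * (∑ j, Real.log (u j)) + 1) :=
        mul_le_mul_of_nonneg_left hlog (by positivity)
    _ = _ := by ring

/-- Proposition 5: Classification under the hinge loss
`Φ_H(u) = max(1+u,0)` (so `Q(z,g) = max(1 − y g(x), 0)` and the hinge risk is minimized by
`sign(η)`).  For every `β > 0` the mirror averaging aggregate with the sparsity prior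
satisfies the stated sparsity oracle inequality with remainder
`2(1+RL_φ)²/β · e^{(1+RL_φ)/β} + 4τL_φ√M + β/(n+1)`. -/
theorem ma_hinge_soi
    {X : Type} [MeasurableSpace X]
    (n M : ℕ) (hM : 2 ≤ M)
    (τ R : ℝ) (hτ : 0 < τ) (hR : 2 * M * τ < R)
    (P : Measure (X × ℝ)) [IsProbabilityMeasure P]
    (hlabels : ∀ᵐ z ∂P, z.2 = 1 ∨ z.2 = -1)
    (PX : Measure X) (hPX : PX = P.map Prod.fst)
    -- the regression function η(x) = E(Y₁ | X₁ = x)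
    (η : X → ℝ) (hηmeas : Measurable η)
    (hη : ∀ A : Set X, MeasurableSet A →
      (∫ z in {z : X × ℝ | z.1 ∈ A}, z.2 ∂P) = ∫ x in A, η x ∂PX)
    -- the dictionary, bounded by L_φ
    (φ : Fin M → X → ℝ) (hφmeas : ∀ j, Measurable (φ j))
    (Lφ : ℝ) (hLφ : 0 < Lφ)
    (hφbound : ∀ j, ∀ᵐ x ∂PX, |φ j x| ≤ Lφ)
    (flam : (Fin M → ℝ) → X → ℝ)
    (hflam : ∀ (l : Fin M → ℝ) (x : X), flam l x = ∑ j, l j * φ j x)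
    (β : ℝ) (hβpos : 0 < β)
    -- the sparsity prior (with normalizing constant c)
    (c : ℝ) (hc : 0 < c)
    (π : Measure (Fin M → ℝ))
    (hπ : π = volume.withDensity fun l => ENNReal.ofReal
      (if (∑ j, |l j|) ≤ R then c * ∏ j, ((τ ^ 2 + l j ^ 2) ^ 2)⁻¹ else 0))
    (hπprob : IsProbabilityMeasure π)
    -- the mirror averaging aggregate with Q(z,g) = max(1 − y g(x), 0)
    (θ : ℕ → (Fin n → X × ℝ) → (Fin M → ℝ) → ℝ)
    (hθ : ∀ (m : ℕ) (z : Fin n → X × ℝ) (l : Fin M → ℝ), θ m z l =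
      Real.exp (-(∑ i ∈ Finset.univ.filter (fun i : Fin n => (i : ℕ) < m),
          max (1 - (z i).2 * flam l (z i).1) 0) / β) /
        ∫ w, Real.exp (-(∑ i ∈ Finset.univ.filter (fun i : Fin n => (i : ℕ) < m),
          max (1 - (z i).2 * flam w (z i).1) 0) / β) ∂π)
    (fhat : (Fin n → X × ℝ) → X → ℝ)
    (hfhat : ∀ (z : Fin n → X × ℝ) (x : X), fhat z x =
      ((n : ℝ) + 1)⁻¹ * ∑ m ∈ Finset.range (n + 1), ∫ l, θ m z l * flam l x ∂π) :
    ∀ lstar : Fin M → ℝ, (∑ j, |lstar j|) ≤ R - 2 * M * τ →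
      (∫ z, ((∫ w, max (1 - w.2 * fhat z w.1) 0 ∂P) -
          ∫ w, max (1 - w.2 * Real.sign (η w.1)) 0 ∂P)
          ∂(Measure.pi fun _ : Fin n => P)) ≤
        ((∫ w, max (1 - w.2 * flam lstar w.1) 0 ∂P) -
            ∫ w, max (1 - w.2 * Real.sign (η w.1)) 0 ∂P) +
          (4 * β / (n + 1)) * (∑ j, Real.log (1 + τ⁻¹ * |lstar j|)) +
          (2 * (1 + R * Lφ) ^ 2 / β * Real.exp ((1 + R * Lφ) / β) +
            (4 * τ * Lφ * Real.sqrt M + β / (n + 1))) := by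
  intro a ha
  obtain rfl : flam = fun l x => ∑ j, l j * φ j x := funext fun l => funext fun x => hflam l x
  set Q : X × ℝ → (Fin M → ℝ) → ℝ := fun w l => max (1 - w.2 * ∑ j, l j * φ j w.1) 0 with hQdef
  have hM0 : 0 < M := by omega
  have hMr : (0 : ℝ) < M := by exact_mod_cast hM0
  have hR0 : 0 < R := lt_trans (by positivity) hR
  have hn : (0 : ℝ) < n + 1 := by positivity
  have hflin : Measurable fun p : X × (Fin M → ℝ) => ∑ j, p.2 j * φ j p.1 := by
    have : ∀ j, Measurable fun p : X × (Fin M → ℝ) => φ j p.1 := fun j =>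
      (hφmeas j).comp measurable_fst
    fun_prop
  have hQ : Measurable (Function.uncurry Q) := by
    have h : Measurable fun p : (X × ℝ) × (Fin M → ℝ) => ∑ j, p.2 j * φ j p.1.1 :=
      hflin.comp ((measurable_fst.comp measurable_fst).prodMk measurable_snd)
    exact (measurable_const.sub ((measurable_snd.comp measurable_fst).mul h)).max measurable_const
  have hQ0 : ∀ z l, 0 ≤ Q z l := fun z l => le_max_right _ _
  have hgood : ∀ᵐ w ∂P, (w.2 = 1 ∨ w.2 = -1) ∧ ∀ j, |φ j w.1| ≤ Lφ := by
    refine hlabels.and (ae_all_iff.2 fun j => ?_)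
    have := hφbound j
    rw [hPX] at this
    exact ae_of_ae_map measurable_fst.aemeasurable this
  have hπR := ae_sum_abs_le_of_sparsityPrior hπ
  have hQb : ∀ᵐ w ∂P, ∀ᵐ l ∂π, Q w l ≤ 1 + R * Lφ := by
    filter_upwards [hgood] with w hw
    filter_upwards [hπR] with l hl
    exact hinge_le hw.1 (abs_sum_mul_le hLφ.le hl hw.2)
  obtain ⟨ρ, hρprob, hρ, hdev⟩ :=
    exists_measure_smul_le_sparsityPrior hM0 hτ hc hπ hπprob a ha
  set κ : ℝ := 1 / 2 * ∏ j, ((1 + τ⁻¹ * |a j|) ^ 4)⁻¹ with hκdef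
  have hfac : ∀ j, 0 < 1 + τ⁻¹ * |a j| := fun j => by positivity
  have hκ : 0 < κ := mul_pos (by norm_num)
    (Finset.prod_pos fun j _ => inv_pos.2 (pow_pos (hfac j) 4))
  have hθ' : ∀ m z l, θ m z l =
      gibbsWeight β Q (Finset.univ.filter fun i : Fin n => (i : ℕ) < m) z l /
        gibbsPartition π β Q (Finset.univ.filter fun i : Fin n => (i : ℕ) < m) z := hθ
  have hfhatm : Measurable fun q : (Fin n → X × ℝ) × X => fhat q.1 q.2 := by
    simp only [hfhat, hθ']
    exact measurable_const.mul (Finset.measurable_sum _ fun m _ =>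
      measurable_integral_gibbsWeight_div_mul hQ _ hflin)
  set G : (Fin n → X × ℝ) × (X × ℝ) → ℝ := fun p => ((n : ℝ) + 1)⁻¹ *
    ∑ m ∈ Finset.range (n + 1),
      gibbsLoss π β Q (Finset.univ.filter fun i : Fin n => (i : ℕ) < m) p.1 p.2 with hG
  set H : (Fin n → X × ℝ) × (X × ℝ) → ℝ := fun p => max (1 - p.2.2 * fhat p.1 p.2.1) 0 with hH
  have hGint : Integrable G ((Measure.pi fun _ : Fin n => P).prod P) :=
    (integrable_finsetSum _ fun m _ => integrable_gibbsLoss_prod hβpos hQ hQ0 hQb _).const_mul _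
  have hHm : Measurable H := by
    have h : Measurable fun p : (Fin n → X × ℝ) × (X × ℝ) => fhat p.1 p.2.1 :=
      hfhatm.comp (measurable_fst.prodMk (measurable_fst.comp measurable_snd))
    exact (measurable_const.sub ((measurable_snd.comp measurable_snd).mul h)).max measurable_const
  have hHG : H ≤ᵐ[(Measure.pi fun _ : Fin n => P).prod P] G := by
    filter_upwards [Measure.quasiMeasurePreserving_snd.ae hgood] with p hp
    have hG0 : 0 ≤ G p := mul_nonneg (by positivity)
      (Finset.sum_nonneg fun m _ => gibbsLoss_nonneg hβpos hQ hQ0 _ _ _)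
    refine max_le ?_ hG0
    have hlin : Measurable fun l : Fin M → ℝ => ∑ j, l j * φ j p.2.1 := by fun_prop
    have hm : ∀ m ∈ Finset.range (n + 1), 1 - p.2.2 * ∫ l, θ m p.1 l * ∑ j, l j * φ j p.2.1 ∂π ≤
        gibbsLoss π β Q (Finset.univ.filter fun i : Fin n => (i : ℕ) < m) p.1 p.2 := by
      intro m _
      simp only [hθ']
      exact one_sub_mul_integral_le_gibbsLoss hβpos hQ hQ0 _ p.1 hlin
        (hπR.mono fun l hl => abs_sum_mul_le hLφ.le hl hp.2)
        (hπR.mono fun l hl => hinge_le hp.1 (abs_sum_mul_le hLφ.le hl hp.2))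
        fun l => le_max_left _ _
    have hsum := Finset.sum_le_sum hm
    rw [Finset.sum_sub_distrib, ← Finset.mul_sum] at hsum
    simp only [Finset.sum_const, Finset.card_range, nsmul_eq_mul, mul_one, Nat.cast_add,
      Nat.cast_one] at hsum
    have hscaled := mul_le_mul_of_nonneg_left hsum (inv_nonneg.2 hn.le)
    rw [mul_sub, inv_mul_cancel₀ hn.ne'] at hscaled
    rw [hfhat]
    simp only [hG]
    linarith
  have hHint : Integrable H ((Measure.pi fun _ : Fin n => P).prod P) := by
    refine hGint.mono' hHm.aestronglyMeasurable ?_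
    filter_upwards [hHG] with p hp
    rwa [Real.norm_of_nonneg (le_max_right _ _)]
  have hrisk : ∫ z, ∫ w, max (1 - w.2 * fhat z w.1) 0 ∂P ∂(Measure.pi fun _ : Fin n => P) ≤
      (1 + R * Lφ) ^ 2 / (2 * β) - β * Real.log κ / (n + 1) + ∫ w, ∫ l, Q w l ∂ρ ∂P := by
    have h := integral_prod H hHint
    calc _ = ∫ p, H p ∂((Measure.pi fun _ : Fin n => P).prod P) := h.symm
      _ ≤ ∫ p, G p ∂((Measure.pi fun _ : Fin n => P).prod P) := integral_mono_ae hHint hGint hHG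
      _ ≤ _ := integral_average_gibbsLoss_le hβpos hQ hQ0 hQb hκ hρ
  have haR : ∑ j, |a j| ≤ R := ha.trans (by linarith [show 0 < 2 * M * τ by positivity])
  have hQa : Integrable (fun w => Q w a) P := by
    refine Integrable.of_bound (hQ.comp measurable_prodMk_right).aestronglyMeasurable
      (1 + R * Lφ) ?_
    filter_upwards [hgood] with w hw
    rw [Real.norm_of_nonneg (hQ0 _ _)]
    exact hinge_le hw.1 (abs_sum_mul_le hLφ.le haR hw.2)
  have hρrisk : ∫ w, ∫ l, Q w l ∂ρ ∂P ≤ ∫ w, Q w a ∂P + 4 * τ * Lφ * Real.sqrt M := by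
    calc ∫ w, ∫ l, Q w l ∂ρ ∂P ≤ ∫ w, (Q w a + 4 * τ * Lφ * Real.sqrt M) ∂P := by
          refine integral_mono_of_nonneg
            (Filter.Eventually.of_forall fun w => integral_nonneg (hQ0 w))
            (hQa.add (integrable_const _)) ?_
          filter_upwards [hgood] with w hw
          obtain ⟨hint, hle⟩ := hdev Lφ hLφ (fun j => φ j w.1) hw.2
          calc ∫ l, Q w l ∂ρ ≤ ∫ l, (Q w a + |∑ j, (l j - a j) * φ j w.1|) ∂ρ := by
                refine integral_mono_of_nonneg (Filter.Eventually.of_forall (hQ0 w))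
                  ((integrable_const _).add hint) (Filter.Eventually.of_forall fun l => ?_)
                have := hinge_le_hinge_add_abs_sub hw.1 (∑ j, l j * φ j w.1) (∑ j, a j * φ j w.1)
                rwa [← Finset.sum_sub_distrib, ← Finset.sum_congr rfl fun j _ =>
                  sub_mul (l j) (a j) (φ j w.1)] at this
            _ ≤ Q w a + 4 * τ * Lφ * Real.sqrt M := by
                rw [integral_add (integrable_const _) hint]
                simpa using hle
      _ = _ := by rw [integral_add hQa (integrable_const _)]; simp
  have hconst := sq_div_le_mul_exp hβpos (show 0 ≤ 1 + R * Lφ by positivity)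
  have hcompl := neg_mul_log_div_le hβpos hn hfac
  have hA : Integrable (fun z => ∫ w, max (1 - w.2 * fhat z w.1) 0 ∂P)
      (Measure.pi fun _ : Fin n => P) := hHint.integral_prod_left
  rw [integral_sub hA (integrable_const _)]
  simp only [integral_const, probReal_univ, one_smul]
  have hQa' : ∫ w, Q w a ∂P = ∫ w, max (1 - w.2 * ∑ j, a j * φ j w.1) 0 ∂P := rfl
  linarith
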